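/- M contains a multicolored k-clique if and only if the instance I' has a solution. -/

import Mathlib

namespace MCC

/-- `k₀ = k + C(k,2)`. -/
def k0 (k : ℕ) : ℕ := k + Nat.choose k 2

/-- `K = k + 3·C(k,2)`, the cut budget. -/
def KK (k : ℕ) : ℕ := k + 3 * Nat.choose k 2

/-- `z = k₀² · n⁵`. -/
def z (k n : ℕ) : ℕ := (k0 k)^2 * n^5

/-- `b_j = k₀^{2j} · z` (`j` is 1-based). -/
def bb (k n j : ℕ) : ℕ := (k0 k)^(2*j) * z k n

/-- `c_j = k₀^{2(k+j)} · z` (`j` is 1-based). -/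
def cc (k n j : ℕ) : ℕ := (k0 k)^(2*(k+j)) * z k n

/-- `c_j^q = c_k · k₀^{2((j−1)k − j(j−1)/2 + q − j)}` (`j, q` are 1-based, `j < q`). -/
def cjq (k n j q : ℕ) : ℕ := cc k n k * (k0 k)^(2*((j-1)*k - j*(j-1)/2 + q - j))

/-- The number of vertices of each copy of the star `S_fix`: `c_{k−1}^k + K + 1`. -/
def fixSize (k n : ℕ) : ℕ := cjq k n (k-1) k + KK k + 1

/-- The number of vertices of the vertex-gadget star `S_{v_i^j}`:
`c_j − (k−1)·b_j − (k−1)·x_i`, for the vertex `v = (j, i)`. -/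
def vgSize (k n : ℕ) (x : Fin n → ℕ) (v : Fin k × Fin n) : ℕ :=
  cc k n (v.1.1 + 1) - (k-1) * bb k n (v.1.1 + 1) - (k-1) * x v.2

/-- The number of vertices of the star `S'_{v_i^j}`: `b_j + x_i`, for the vertex `v = (j, i)`. -/
def spSize (k n : ℕ) (x : Fin n → ℕ) (v : Fin k × Fin n) : ℕ := bb k n (v.1.1 + 1) + x v.2

/-- Index type for the edges of `M`: ordered pairs of adjacent vertices, with the endpoint of
smaller color first. Each edge of `M` appears exactly once (the coloring being proper). -/
def EIdx (k n : ℕ) (M : SimpleGraph (Fin k × Fin n)) : Type :=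
  {p : (Fin k × Fin n) × (Fin k × Fin n) // M.Adj p.1 p.2 ∧ p.1.1 < p.2.1}

/-- The number of vertices of the star `S_e` of the edge-gadget `T_e`: `c_j^q` for an edge `e`
between color classes `j < q`. -/
def seSize (k n : ℕ) {M : SimpleGraph (Fin k × Fin n)} (e : EIdx k n M) : ℕ :=
  cjq k n (e.1.1.1.1 + 1) (e.1.2.1.1 + 1)

/-- The vertex type of the tree `T` of the instance `I'`: the root `r` (the `Unit` summand);
for each vertex `v` of `M` the star `S_v` (root `none`, leaves `some _`); for each edge `e`
of `M` the edge-gadget `T_e` consisting of the star `S_e` and the two stars `S'` attached to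
its two endpoints; and `K+1` copies of the star `S_fix`. -/
abbrev VV (k n : ℕ) (x : Fin n → ℕ) (M : SimpleGraph (Fin k × Fin n)) : Type :=
  Unit ⊕
  (Σ v : Fin k × Fin n, Option (Fin (vgSize k n x v - 1))) ⊕
  (Σ e : EIdx k n M,
    (Option (Fin (seSize k n e - 1)) ⊕ Option (Fin (spSize k n x e.1.1 - 1)) ⊕
      Option (Fin (spSize k n x e.1.2 - 1)))) ⊕
  (Fin (KK k + 1) × Option (Fin (fixSize k n - 1)))

/-- Classify a vertex of an edge-gadget: which of the three stars it belongs to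
(`0` for `S_e`, `1` and `2` for the two `S'`-stars) and whether it is that star's root. -/
def code {A B C : Type} : (Option A ⊕ Option B ⊕ Option C) → ℕ × Bool
  | Sum.inl none => (0, true)
  | Sum.inl (some _) => (0, false)
  | Sum.inr (Sum.inl none) => (1, true)
  | Sum.inr (Sum.inl (some _)) => (1, false)
  | Sum.inr (Sum.inr none) => (2, true)
  | Sum.inr (Sum.inr (some _)) => (2, false)

/-- Adjacency inside an edge-gadget `T_e`: the root `r_e` of `S_e` is joined to the leaves of
`S_e` and to the roots of the two `S'`-stars, and the root of each `S'`-star is joined to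
its leaves. -/
def codeRel : ℕ × Bool → ℕ × Bool → Prop
  | (0, true), (0, false) => True
  | (0, true), (1, true) => True
  | (0, true), (2, true) => True
  | (1, true), (1, false) => True
  | (2, true), (2, false) => True
  | _, _ => False

/-- The (directed) edge relation of the tree `T` of the instance `I'`. -/
def relMCC (k n : ℕ) (x : Fin n → ℕ) (M : SimpleGraph (Fin k × Fin n)) :
    VV k n x M → VV k n x M → Prop
  | Sum.inl _, Sum.inr (Sum.inl ⟨_, d⟩) => d = none
  | Sum.inr (Sum.inl ⟨u, d⟩), Sum.inr (Sum.inl ⟨u', d'⟩) => u = u' ∧ d = none ∧ d' ≠ none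
  | Sum.inl _, Sum.inr (Sum.inr (Sum.inl ⟨_, d⟩)) => code d = (0, true)
  | Sum.inr (Sum.inr (Sum.inl ⟨e, d⟩)), Sum.inr (Sum.inr (Sum.inl ⟨e', d'⟩)) =>
      e = e' ∧ codeRel (code d) (code d')
  | Sum.inl _, Sum.inr (Sum.inr (Sum.inr (_, d))) => d = none
  | Sum.inr (Sum.inr (Sum.inr (c, d))), Sum.inr (Sum.inr (Sum.inr (c', d'))) =>
      c = c' ∧ d = none ∧ d' ≠ none
  | _, _ => False

/-- The tree `T` of the instance `I'`. -/
def TG (k n : ℕ) (x : Fin n → ℕ) (M : SimpleGraph (Fin k × Fin n)) : SimpleGraph (VV k n x M) :=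
  SimpleGraph.fromRel (relMCC k n x M)

/-- The root `r` of `T`. -/
def rootT (k n : ℕ) (x : Fin n → ℕ) (M : SimpleGraph (Fin k × Fin n)) : VV k n x M :=
  Sum.inl ()

/-- The root `r_{v_i^j}` of the vertex-gadget star `S_{v_i^j}`. -/
def vgRoot (k n : ℕ) (x : Fin n → ℕ) (M : SimpleGraph (Fin k × Fin n)) (v : Fin k × Fin n) :
    VV k n x M :=
  Sum.inr (Sum.inl ⟨v, none⟩)

/-- The root `r_e` of the star `S_e` of the edge-gadget `T_e`. -/
def seRoot (k n : ℕ) (x : Fin n → ℕ) {M : SimpleGraph (Fin k × Fin n)} (e : EIdx k n M) :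
    VV k n x M :=
  Sum.inr (Sum.inr (Sum.inl ⟨e, Sum.inl none⟩))

/-- The root `r'_{v_i^j}` of the star `S'` of the lower-colored endpoint of `e`. -/
def sp1Root (k n : ℕ) (x : Fin n → ℕ) {M : SimpleGraph (Fin k × Fin n)} (e : EIdx k n M) :
    VV k n x M :=
  Sum.inr (Sum.inr (Sum.inl ⟨e, Sum.inr (Sum.inl none)⟩))

/-- The root `r'_{v_p^q}` of the star `S'` of the higher-colored endpoint of `e`. -/
def sp2Root (k n : ℕ) (x : Fin n → ℕ) {M : SimpleGraph (Fin k × Fin n)} (e : EIdx k n M) :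
    VV k n x M :=
  Sum.inr (Sum.inr (Sum.inl ⟨e, Sum.inr (Sum.inr none)⟩))

/-- The vertex set of the vertex-gadget star `S_v`. -/
def vgSet (k n : ℕ) (x : Fin n → ℕ) (M : SimpleGraph (Fin k × Fin n)) (v : Fin k × Fin n) :
    Set (VV k n x M) :=
  {w | ∃ d, w = Sum.inr (Sum.inl ⟨v, d⟩)}

/-- The vertex set of the star `S_e` of the edge-gadget `T_e`. -/
def SeSet (k n : ℕ) (x : Fin n → ℕ) {M : SimpleGraph (Fin k × Fin n)} (e : EIdx k n M) :
    Set (VV k n x M) :=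
  {w | ∃ d, w = Sum.inr (Sum.inr (Sum.inl ⟨e, Sum.inl d⟩))}

/-- The groups of the instance `I'`: the groups `G_1, …, G_k`, the groups `G_j^q` for
`1 ≤ j < q ≤ k`, and the group `G_rest`. -/
abbrev Grp (k : ℕ) : Type := Fin k ⊕ {pq : Fin k × Fin k // pq.1 < pq.2} ⊕ Unit

/-- The group `G_j`. -/
def gCol {k : ℕ} (j : Fin k) : Grp k := Sum.inl j

/-- The group `G_j^q`. -/
def gPair {k : ℕ} (pq : {pq : Fin k × Fin k // pq.1 < pq.2}) : Grp k := Sum.inr (Sum.inl pq)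

/-- The group `G_rest`. -/
def gRest (k : ℕ) : Grp k := Sum.inr (Sum.inr ())

/-- `t = |V(T)|`. -/
noncomputable def tTot (k n : ℕ) (x : Fin n → ℕ) (M : SimpleGraph (Fin k × Fin n)) : ℕ :=
  (Set.univ : Set (VV k n x M)).ncard

/-- `t' = t − Σ_j c_j − Σ_{j<q} c_j^q`, the size of the group `G_rest`. -/
noncomputable def tRest (k n : ℕ) (x : Fin n → ℕ) (M : SimpleGraph (Fin k × Fin n)) : ℕ :=
  tTot k n x M - (∑ j : Fin k, cc k n (j.1 + 1)) -
    ∑ pq : {pq : Fin k × Fin k // pq.1 < pq.2}, cjq k n (pq.1.1.1 + 1) (pq.1.2.1 + 1)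

/-- The prescribed sizes of the groups: `G_j` has size `c_j`, `G_j^q` has size `c_j^q`,
and `G_rest` has size `t'`. -/
noncomputable def sizesMCC (k n : ℕ) (x : Fin n → ℕ) (M : SimpleGraph (Fin k × Fin n)) :
    Grp k → ℕ
  | Sum.inl j => cc k n (j.1 + 1)
  | Sum.inr (Sum.inl pq) => cjq k n (pq.1.1.1 + 1) (pq.1.2.1 + 1)
  | Sum.inr (Sum.inr _) => tRest k n x M

/-- A solution cutting at most `kk` edges: `EP` is a set of at most `kk` edges of `T`, and
`lam` assigns the connected components of `T − EP` to the groups (it is constant on each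
component) so that each group `g` receives exactly `sizes g` vertices. -/
def IsSolutionLe {V G : Type} (T : SimpleGraph V) (EP : Set (Sym2 V)) (kk : ℕ)
    (sizes : G → ℕ) (lam : V → G) : Prop :=
  EP ⊆ T.edgeSet ∧ EP.ncard ≤ kk ∧
    (∀ v w : V, (T.deleteEdges EP).Reachable v w → lam v = lam w) ∧
    ∀ g : G, {v | lam v = g}.ncard = sizes g

/-- `C` is a `P`-component: a connected component of `T − EP`. -/
def IsPComp {V : Type} (T : SimpleGraph V) (EP : Set (Sym2 V)) (C : Set V) : Prop :=
  ∃ v : V, C = {w | (T.deleteEdges EP).Reachable v w}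

/-- `M` contains a multicolored `k`-clique: one vertex of each color class, pairwise adjacent. -/
def HasMCClique (k n : ℕ) (M : SimpleGraph (Fin k × Fin n)) : Prop :=
  ∃ sel : Fin k → Fin n, ∀ j j' : Fin k, j ≠ j' → M.Adj (j, sel j) (j', sel j')

/-- The instance `I'` has a solution. -/
def HasSol (k n : ℕ) (x : Fin n → ℕ) (M : SimpleGraph (Fin k × Fin n)) : Prop :=
  ∃ (EP : Set (Sym2 (VV k n x M))) (lam : VV k n x M → Grp k),
    IsSolutionLe (TG k n x M) EP (KK k) (sizesMCC k n x M) lam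

section aux
open Classical

noncomputable instance instFintypeEIdx (k n : ℕ) (M : SimpleGraph (Fin k × Fin n)) :
    Fintype (EIdx k n M) := by
  unfold EIdx; infer_instance

abbrev St (k n : ℕ) (M : SimpleGraph (Fin k × Fin n)) : Type :=
  (Fin k × Fin n) ⊕ EIdx k n M ⊕ (EIdx k n M × Bool) ⊕ Fin (KK k + 1)

variable {k n : ℕ} {x : Fin n → ℕ} {M : SimpleGraph (Fin k × Fin n)}

def ep (s : EIdx k n M × Bool) : Fin k × Fin n := if s.2 then s.1.1.1 else s.1.1.2

def wt (x : Fin n → ℕ) : St k n M → ℕ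
  | Sum.inl v => vgSize k n x v
  | Sum.inr (Sum.inl e) => seSize k n e
  | Sum.inr (Sum.inr (Sum.inl s)) => spSize k n x (ep s)
  | Sum.inr (Sum.inr (Sum.inr _)) => fixSize k n

def ctr (x : Fin n → ℕ) : St k n M → VV k n x M
  | Sum.inl v => Sum.inr (Sum.inl ⟨v, none⟩)
  | Sum.inr (Sum.inl e) => Sum.inr (Sum.inr (Sum.inl ⟨e, Sum.inl none⟩))
  | Sum.inr (Sum.inr (Sum.inl (e, true))) => Sum.inr (Sum.inr (Sum.inl ⟨e, Sum.inr (Sum.inl none)⟩))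
  | Sum.inr (Sum.inr (Sum.inl (e, false))) => Sum.inr (Sum.inr (Sum.inl ⟨e, Sum.inr (Sum.inr none)⟩))
  | Sum.inr (Sum.inr (Sum.inr c)) => Sum.inr (Sum.inr (Sum.inr (c, none)))

def st : VV k n x M → Option (St k n M)
  | Sum.inl _ => none
  | Sum.inr (Sum.inl ⟨v, _⟩) => some (Sum.inl v)
  | Sum.inr (Sum.inr (Sum.inl ⟨e, Sum.inl _⟩)) => some (Sum.inr (Sum.inl e))
  | Sum.inr (Sum.inr (Sum.inl ⟨e, Sum.inr (Sum.inl _)⟩)) => some (Sum.inr (Sum.inr (Sum.inl (e, true))))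
  | Sum.inr (Sum.inr (Sum.inl ⟨e, Sum.inr (Sum.inr _)⟩)) => some (Sum.inr (Sum.inr (Sum.inl (e, false))))
  | Sum.inr (Sum.inr (Sum.inr (c, _))) => some (Sum.inr (Sum.inr (Sum.inr c)))

def par : VV k n x M → VV k n x M
  | Sum.inl _ => Sum.inl ()
  | Sum.inr (Sum.inl ⟨_, none⟩) => Sum.inl ()
  | Sum.inr (Sum.inl ⟨v, some _⟩) => Sum.inr (Sum.inl ⟨v, none⟩)
  | Sum.inr (Sum.inr (Sum.inl ⟨_, Sum.inl none⟩)) => Sum.inl ()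
  | Sum.inr (Sum.inr (Sum.inl ⟨e, Sum.inl (some _)⟩)) => Sum.inr (Sum.inr (Sum.inl ⟨e, Sum.inl none⟩))
  | Sum.inr (Sum.inr (Sum.inl ⟨e, Sum.inr (Sum.inl none)⟩)) => Sum.inr (Sum.inr (Sum.inl ⟨e, Sum.inl none⟩))
  | Sum.inr (Sum.inr (Sum.inl ⟨e, Sum.inr (Sum.inl (some _))⟩)) => Sum.inr (Sum.inr (Sum.inl ⟨e, Sum.inr (Sum.inl none)⟩))
  | Sum.inr (Sum.inr (Sum.inl ⟨e, Sum.inr (Sum.inr none)⟩)) => Sum.inr (Sum.inr (Sum.inl ⟨e, Sum.inl none⟩))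
  | Sum.inr (Sum.inr (Sum.inl ⟨e, Sum.inr (Sum.inr (some _))⟩)) => Sum.inr (Sum.inr (Sum.inl ⟨e, Sum.inr (Sum.inr none)⟩))
  | Sum.inr (Sum.inr (Sum.inr (_, none))) => Sum.inl ()
  | Sum.inr (Sum.inr (Sum.inr (c, some _))) => Sum.inr (Sum.inr (Sum.inr (c, none)))

def cen (v : VV k n x M) : VV k n x M :=
  match st v with
  | none => Sum.inl ()
  | some s => ctr x s

lemma st_ctr (s : St k n M) : st (ctr x s) = some s := by
  rcases s with v | e | ⟨e, b⟩ | c <;> try rfl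
  cases b <;> rfl

lemma cen_ctr (s : St k n M) : cen (ctr x s) = ctr x s := by
  simp [cen, st_ctr]

lemma ctr_inj : Function.Injective (ctr x : St k n M → VV k n x M) := by
  intro a b h
  have := congrArg st h
  simpa [st_ctr] using this

lemma par_of_ne (v : VV k n x M) (h : v ≠ cen v) : par v = cen v := by
  rcases v with _ | ⟨v, _ | _⟩ | ⟨e, (_ | _) | (_ | _) | (_ | _)⟩ | ⟨c, _ | _⟩ <;>
    first | rfl | exact absurd rfl h

lemma cen_cases (v : VV k n x M) (h : v = cen v) : v = Sum.inl () ∨ ∃ s, v = ctr x s := by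
  unfold cen at h
  split at h
  · exact Or.inl h
  · exact Or.inr ⟨_, h⟩

lemma par_par_ne (v : VV k n x M) (h : v ≠ Sum.inl ()) : par (par v) ≠ v := by
  rcases v with _ | ⟨v, _ | _⟩ | ⟨e, (_ | _) | (_ | _) | (_ | _)⟩ | ⟨c, _ | _⟩ <;>
    first | exact absurd rfl h | simp [par]

lemma par_ne (v : VV k n x M) (h : v ≠ Sum.inl ()) : par v ≠ v := by
  rcases v with _ | ⟨v, _ | _⟩ | ⟨e, (_ | _) | (_ | _) | (_ | _)⟩ | ⟨c, _ | _⟩ <;>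
    first | exact absurd rfl h | simp [par]

lemma rel_iff (a b : VV k n x M) : relMCC k n x M a b ↔ b ≠ Sum.inl () ∧ a = par b := by
  rcases a with _ | ⟨v, _ | _⟩ | ⟨e, (_ | _) | (_ | _) | (_ | _)⟩ | ⟨c, _ | _⟩ <;>
  rcases b with _ | ⟨v', _ | _⟩ | ⟨e', (_ | _) | (_ | _) | (_ | _)⟩ | ⟨c', _ | _⟩ <;>
  simp [relMCC, par, code, codeRel] <;>
  (rintro rfl; simp)

lemma adj_iff (a b : VV k n x M) : (TG k n x M).Adj a b ↔
    (b ≠ Sum.inl () ∧ a = par b) ∨ (a ≠ Sum.inl () ∧ b = par a) := by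
  simp only [TG, SimpleGraph.fromRel_adj, rel_iff]
  constructor
  · exact fun h => h.2
  · intro h
    refine ⟨?_, h⟩
    rintro rfl
    rcases h with ⟨h, h'⟩ | ⟨h, h'⟩ <;> exact par_ne _ h h'.symm

lemma hasSol_iff : HasSol k n x M ↔ ∃ lam : VV k n x M → Grp k,
    {v | lam v ≠ lam (par v)}.ncard ≤ KK k ∧
      ∀ g, {v | lam v = g}.ncard = sizesMCC k n x M g := by
  constructor
  · rintro ⟨EP, lam, h1, h2, h3, h4⟩
    refine ⟨lam, le_trans ?_ h2, h4⟩
    refine Set.ncard_le_ncard_of_injOn (fun v => s(v, par v)) ?_ ?_ (Set.toFinite _)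
    · intro v hv
      by_contra hne
      apply hv
      apply h3
      apply SimpleGraph.Adj.reachable
      rw [SimpleGraph.deleteEdges_adj]
      refine ⟨?_, hne⟩
      rw [adj_iff]
      right
      refine ⟨?_, rfl⟩
      rintro rfl
      exact hv rfl
    · intro v hv w hw h
      have hv0 : v ≠ Sum.inl () := by rintro rfl; exact hv rfl
      rcases Sym2.eq_iff.1 h with ⟨h, _⟩ | ⟨h, h'⟩
      · exact h
      · exact absurd (by rw [h', ← h]) (par_par_ne v hv0)
  · rintro ⟨lam, h1, h2⟩
    refine ⟨(fun v => s(v, par v)) '' {v | lam v ≠ lam (par v)}, lam, ?_, ?_, ?_, h2⟩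
    · rintro _ ⟨v, hv, rfl⟩
      have hv0 : v ≠ Sum.inl () := by rintro rfl; exact hv rfl
      rw [SimpleGraph.mem_edgeSet, adj_iff]
      exact Or.inr ⟨hv0, rfl⟩
    · exact le_trans (Set.ncard_image_le (Set.toFinite _)) h1
    · rintro v w ⟨p⟩
      induction p with
      | nil => rfl
      | cons h p ih =>
        rw [← ih]
        rw [SimpleGraph.deleteEdges_adj, adj_iff] at h
        obtain ⟨h, h'⟩ := h
        by_contra hne
        apply h'
        rcases h with ⟨_, rfl⟩ | ⟨_, rfl⟩
        · exact ⟨_, fun h => hne h.symm, Sym2.eq_swap⟩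
        · exact ⟨_, hne, rfl⟩

lemma card_star (hw : ∀ s : St k n M, 1 ≤ wt x s) (s : St k n M) :
    (Finset.univ.filter (fun v : VV k n x M => st v = some s)).card = wt x s := by
  have key : ∀ (m : ℕ) (_ : 1 ≤ m) (i : Option (Fin (m - 1)) → VV k n x M) (_ : Function.Injective i)
    (_ : ∀ v, st v = some s ↔ ∃ d, i d = v),
    (Finset.univ.filter (fun v : VV k n x M => st v = some s)).card = m := by
    intro m hm i hi hs
    have : (Finset.univ.filter (fun v : VV k n x M => st v = some s)) = Finset.univ.image i := by
      ext v; simp [hs]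
    rw [this, Finset.card_image_of_injective _ hi]
    simp; omega
  have hws := hw s
  rcases s with v | e | ⟨e, _ | _⟩ | c
  · refine key (vgSize k n x v) hws (fun d => Sum.inr (Sum.inl ⟨v, d⟩)) (fun a b h => by simpa using h)
      (fun w => ⟨?_, by rintro ⟨d, rfl⟩; rfl⟩)
    intro h
    rcases w with _ | ⟨v', d⟩ | ⟨e', d | d | d⟩ | ⟨c', d⟩ <;> simp [st] at h
    subst h
    exact ⟨d, rfl⟩
  · refine key (seSize k n e) hws (fun d => Sum.inr (Sum.inr (Sum.inl ⟨e, Sum.inl d⟩))) (fun a b h => by simpa using h)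
      (fun w => ⟨?_, by rintro ⟨d, rfl⟩; rfl⟩)
    intro h
    rcases w with _ | ⟨v', d⟩ | ⟨e', d | d | d⟩ | ⟨c', d⟩ <;> simp [st] at h
    subst h
    exact ⟨d, rfl⟩
  · refine key (spSize k n x e.1.2) hws (fun d => Sum.inr (Sum.inr (Sum.inl ⟨e, Sum.inr (Sum.inr d)⟩))) (fun a b h => by simpa using h)
      (fun w => ⟨?_, by rintro ⟨d, rfl⟩; rfl⟩)
    intro h
    rcases w with _ | ⟨v', d⟩ | ⟨e', d | d | d⟩ | ⟨c', d⟩ <;> simp [st] at h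
    subst h
    exact ⟨d, rfl⟩
  · refine key (spSize k n x e.1.1) hws (fun d => Sum.inr (Sum.inr (Sum.inl ⟨e, Sum.inr (Sum.inl d)⟩))) (fun a b h => by simpa using h)
      (fun w => ⟨?_, by rintro ⟨d, rfl⟩; rfl⟩)
    intro h
    rcases w with _ | ⟨v', d⟩ | ⟨e', d | d | d⟩ | ⟨c', d⟩ <;> simp [st] at h
    subst h
    exact ⟨d, rfl⟩
  · refine key (fixSize k n) hws (fun d => Sum.inr (Sum.inr (Sum.inr (c, d)))) (fun a b h => by simpa using h)
      (fun w => ⟨?_, by rintro ⟨d, rfl⟩; rfl⟩)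
    intro h
    rcases w with _ | ⟨v', d⟩ | ⟨e', d | d | d⟩ | ⟨c', d⟩ <;> simp [st] at h
    subst h
    exact ⟨d, rfl⟩

noncomputable def W (x : Fin n → ℕ) (f : St k n M → Grp k) (g : Grp k) : ℕ :=
  ∑ s, if f s = g then wt x s else 0

def pf (ρ : Grp k) (f : St k n M → Grp k) : St k n M → Grp k
  | Sum.inl _ => ρ
  | Sum.inr (Sum.inl _) => ρ
  | Sum.inr (Sum.inr (Sum.inl s)) => f (Sum.inr (Sum.inl s.1))
  | Sum.inr (Sum.inr (Sum.inr _)) => ρ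

lemma par_ctr (lam : VV k n x M → Grp k) (s : St k n M) :
    lam (par (ctr x s)) = pf (lam (Sum.inl ())) (fun s => lam (ctr x s)) s := by
  rcases s with v | e | ⟨e, b⟩ | c <;> try rfl
  cases b <;> rfl

lemma st_none (v : VV k n x M) : st v = none ↔ v = Sum.inl () := by
  rcases v with _ | ⟨v', d⟩ | ⟨e', d | d | d⟩ | ⟨c', d⟩ <;> simp [st]

lemma count_cen (hw : ∀ s : St k n M, 1 ≤ wt x s) (lam : VV k n x M → Grp k) (g : Grp k) :
    (Finset.univ.filter (fun v : VV k n x M => lam (cen v) = g)).card =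
      (if lam (Sum.inl ()) = g then 1 else 0) + W x (fun s : St k n M => lam (ctr x s)) g := by
  rw [Finset.card_eq_sum_card_fiberwise (f := st) (t := Finset.univ) (by intro _ _; simp),
    Fintype.sum_option]
  congr 1
  · simp only [Finset.filter_filter]
    split_ifs with h
    · rw [Finset.card_eq_one]
      refine ⟨Sum.inl (), ?_⟩
      ext v
      simp only [Finset.mem_filter, Finset.mem_univ, true_and, st_none, Finset.mem_singleton]
      constructor
      · exact fun h => h.2
      · rintro rfl; exact ⟨h, rfl⟩
    · rw [Finset.card_eq_zero, Finset.filter_eq_empty_iff]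
      rintro v - ⟨h1, h2⟩
      rw [st_none] at h2
      subst h2
      exact h h1
  · unfold W
    refine Finset.sum_congr rfl fun s _ => ?_
    simp only [Finset.filter_filter]
    split_ifs with h
    · rw [← card_star hw s]
      congr 1
      ext v
      simp only [Finset.mem_filter, Finset.mem_univ, true_and, and_iff_right_iff_imp]
      intro hv
      simp [cen, hv, h]
    · rw [Finset.card_eq_zero]
      refine Finset.eq_empty_of_forall_notMem fun v hv => ?_
      simp only [Finset.mem_filter, Finset.mem_univ, true_and] at hv
      obtain ⟨h1, h2⟩ := hv
      simp only [cen, h2] at h1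
      exact h h1

lemma bridge_rev (hw : ∀ s : St k n M, 1 ≤ wt x s) (h : HasSol k n x M) :
    ∃ (ρ : Grp k) (f : St k n M → Grp k) (L : ℕ),
      L + (Finset.univ.filter (fun s => f s ≠ pf ρ f s)).card ≤ KK k ∧
      (∀ g, W x f g ≤ sizesMCC k n x M g + L) ∧
      (∀ g, g ≠ ρ → sizesMCC k n x M g ≤ W x f g + L) := by
  rw [hasSol_iff] at h
  obtain ⟨lam, h1, h2⟩ := h
  rw [Set.ncard_eq_toFinset_card', Set.toFinset_ofPred] at h1
  have h2' : ∀ g, (Finset.univ.filter (fun v => lam v = g)).card = sizesMCC k n x M g := by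
    intro g
    rw [← h2 g, Set.ncard_eq_toFinset_card', Set.toFinset_ofPred]
  refine ⟨lam (Sum.inl ()), fun s => lam (ctr x s),
    (Finset.univ.filter (fun v => lam v ≠ lam (cen v))).card, ?_, ?_, ?_⟩
  · refine le_trans ?_ h1
    rw [← Finset.card_map ⟨ctr x, ctr_inj⟩, ← Finset.card_union_of_disjoint]
    · apply Finset.card_le_card
      intro v hv
      simp only [Finset.mem_union, Finset.mem_filter, Finset.mem_univ, true_and, Finset.mem_map,
        Function.Embedding.coeFn_mk] at hv ⊢
      rcases hv with hv | ⟨s, hs, rfl⟩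
      · rw [par_of_ne v (fun h => hv (congrArg lam h))]
        exact hv
      · rw [par_ctr lam]; exact hs
    · rw [Finset.disjoint_left]
      intro v hv hv'
      simp only [Finset.mem_filter, Finset.mem_univ, true_and, Finset.mem_map,
        Function.Embedding.coeFn_mk] at hv hv'
      obtain ⟨s, hs, rfl⟩ := hv'
      rw [cen_ctr] at hv
      exact hv rfl
  · intro g
    have := count_cen hw lam g
    rw [← h2' g]
    have h3 : (Finset.univ.filter (fun v : VV k n x M => lam (cen v) = g)).card ≤
        (Finset.univ.filter (fun v => lam v = g)).card +
        (Finset.univ.filter (fun v => lam v ≠ lam (cen v))).card := by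
      refine le_trans (Finset.card_le_card ?_) (Finset.card_union_le _ _)
      intro v
      simp only [Finset.mem_union, Finset.mem_filter, Finset.mem_univ, true_and]
      intro hv
      by_cases h : lam v = g
      · exact Or.inl h
      · right; rw [hv]; exact h
    omega
  · intro g hg
    have := count_cen hw lam g
    rw [← h2' g]
    rw [if_neg (Ne.symm hg), zero_add] at this
    rw [← this]
    refine le_trans (Finset.card_le_card ?_) (Finset.card_union_le _ _)
    intro v
    simp only [Finset.mem_union, Finset.mem_filter, Finset.mem_univ, true_and]
    intro hv
    by_cases h : lam (cen v) = g
    · exact Or.inl h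
    · right; rw [hv]; exact Ne.symm h

lemma bridge_fwd (hw : ∀ s : St k n M, 1 ≤ wt x s) (f : St k n M → Grp k)
    (h1 : (Finset.univ.filter (fun s => f s ≠ pf (gRest k) f s)).card ≤ KK k)
    (h2 : ∀ g, g ≠ gRest k → W x f g = sizesMCC k n x M g) : HasSol k n x M := by
  rw [hasSol_iff]
  let lam : VV k n x M → Grp k := fun v => match st v with
    | none => gRest k
    | some s => f s
  have hlc : ∀ v, lam v = lam (cen v) := by
    intro v
    rcases hv : st v with _ | s
    · rw [(st_none v).1 hv]; rfl
    · simp [lam, cen, hv, st_ctr]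
  have hctr : (fun s => lam (ctr x s)) = f := by
    funext s
    simp [lam, st_ctr]
  have hroot : lam (Sum.inl ()) = gRest k := rfl
  have h3 : ∀ g, g ≠ gRest k → (Finset.univ.filter (fun v => lam v = g)).card =
      sizesMCC k n x M g := by
    intro g hg
    have := count_cen hw lam g
    rw [hctr, hroot, if_neg (Ne.symm hg), zero_add, h2 g hg] at this
    rw [← this]
    congr 1
    ext v
    simp [← hlc]
  refine ⟨lam, ?_, ?_⟩
  · rw [Set.ncard_eq_toFinset_card', Set.toFinset_ofPred]
    refine le_trans ?_ h1
    rw [← Finset.card_map ⟨ctr x, ctr_inj⟩]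
    apply Finset.card_le_card
    intro v hv
    simp only [Finset.mem_filter, Finset.mem_univ, true_and, Finset.mem_map,
        Function.Embedding.coeFn_mk] at hv ⊢
    have hvc : v = cen v := by
      by_contra h
      rw [par_of_ne v h] at hv
      exact hv (hlc v)
    rcases cen_cases v hvc with rfl | ⟨s, rfl⟩
    · exact absurd rfl hv
    · refine ⟨s, ?_, rfl⟩
      rw [par_ctr lam, hctr, hroot] at hv
      rwa [← congrFun hctr s]
  · intro g
    rw [Set.ncard_eq_toFinset_card', Set.toFinset_ofPred]
    by_cases hg : g = gRest k
    · subst hg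
      have htot : tTot k n x M = ∑ g : Grp k, (Finset.univ.filter (fun v => lam v = g)).card := by
        unfold tTot
        rw [Set.ncard_univ, Nat.card_eq_fintype_card, ← Finset.card_univ]
        exact Finset.card_eq_sum_card_fiberwise (by intro _ _; simp)
      rw [Fintype.sum_sum_type, Fintype.sum_sum_type] at htot
      have e1 : ∀ j : Fin k, (Finset.univ.filter (fun v => lam v = Sum.inl j)).card =
          cc k n (j.1 + 1) := fun j => h3 _ (by simp [gRest])
      have e2 : ∀ pq : {pq : Fin k × Fin k // pq.1 < pq.2},
          (Finset.univ.filter (fun v => lam v = Sum.inr (Sum.inl pq))).card =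
          cjq k n (pq.1.1.1 + 1) (pq.1.2.1 + 1) := fun j => h3 _ (by simp [gRest])
      simp only [e1, e2, Finset.univ_unique, Finset.sum_singleton] at htot
      change _ = tRest k n x M
      unfold tRest
      rw [htot]
      have : (gRest k) = Sum.inr (Sum.inr default) := rfl
      rw [this]
      rw [Nat.add_sub_cancel_left]
      omega
    · exact h3 g hg

def BB (k : ℕ) : ℕ := (k0 k)^2

def pw (k n m : ℕ) : ℕ := (BB k)^m * z k n

lemma choose_pos' (hk : 2 ≤ k) : 1 ≤ k.choose 2 := Nat.choose_pos hk

lemma two_choose (k : ℕ) : 2 * k.choose 2 = k * (k - 1) := by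
  rw [Nat.choose_two_right]
  exact Nat.mul_div_cancel' (Nat.even_mul_pred_self k).two_dvd

lemma KK_lt (hk : 2 ≤ k) : KK k + 4 ≤ BB k := by
  have := choose_pos' hk
  unfold KK BB k0
  nlinarith

lemma k_lt (hk : 2 ≤ k) : 3 * (k + 1) ≤ BB k := by
  have := choose_pos' hk
  unfold BB k0
  nlinarith

lemma B_ge (hk : 2 ≤ k) : 9 ≤ BB k := by
  have := k_lt hk
  omega

lemma bb_eq (j : ℕ) : bb k n j = pw k n j := by
  unfold bb pw BB; rw [← pow_mul]

lemma cc_eq (j : ℕ) : cc k n j = pw k n (k + j) := by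
  unfold cc pw BB; rw [← pow_mul]

def idx (k a b : ℕ) : ℕ := (a + 1 - 1) * k - (a + 1) * (a + 1 - 1) / 2 + (b + 1) - (a + 1)

lemma cjq_eq (a b : ℕ) : cjq k n (a + 1) (b + 1) = pw k n (2 * k + idx k a b) := by
  unfold cjq
  rw [cc_eq]
  unfold pw BB idx
  rw [← pow_mul, ← pow_mul]
  ring

def TT (k a : ℕ) : ℕ := a * k - (a + 1) * a / 2

lemma TT_succ (a : ℕ) (h : a < k) : TT k (a + 1) = TT k a + (k - (a + 1)) := by
  unfold TT
  have h1 : (a + 1 + 1) * (a + 1) / 2 = (a + 1) * a / 2 + (a + 1) := by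
    have : (a + 1 + 1) * (a + 1) = (a + 1) * a + 2 * (a + 1) := by ring
    omega
  have h2 : (a + 1) * a / 2 ≤ a * k := by
    have : (a + 1) * a ≤ 2 * (a * k) := by nlinarith
    omega
  rw [h1]
  have : (a + 1) * k = a * k + k := by ring
  omega

lemma TT_mono (a b : ℕ) (h : a ≤ b) (hb : b ≤ k) : TT k a ≤ TT k b := by
  induction b, h using Nat.le_induction with
  | base => rfl
  | succ b hab ih => rw [TT_succ b (by omega)]; have := ih (by omega); omega

lemma idx_eq (a b : ℕ) (h : a < b) : idx k a b = TT k a + (b - a) := by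
  unfold idx TT
  simp only [Nat.add_sub_cancel]
  omega

lemma idx_lt (a b a' b' : ℕ) (h : a < b) (hb : b < k) (h' : a' < b') (hb' : b' < k)
    (haa : a < a') : idx k a b < idx k a' b' := by
  rw [idx_eq _ _ h, idx_eq _ _ h']
  have := TT_mono (k := k) (a + 1) a' haa (by omega)
  rw [TT_succ a (by omega)] at this
  omega

lemma idx_inj (a b a' b' : ℕ) (h : a < b) (hb : b < k) (h' : a' < b') (hb' : b' < k)
    (he : idx k a b = idx k a' b') : a = a' ∧ b = b' := by
  rcases lt_trichotomy a a' with h1 | h1 | h1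
  · have := idx_lt a b a' b' h hb h' hb' h1; omega
  · subst h1
    rw [idx_eq _ _ h, idx_eq _ _ h'] at he
    omega
  · have := idx_lt a' b' a b h' hb' h hb h1; omega

lemma idx_max (a b : ℕ) (h : a < b) (hb : b < k) : idx k a b ≤ idx k (k - 2) (k - 1) := by
  by_cases h1 : a = k - 2
  · have : b = k - 1 := by omega
    rw [h1, this]
  · exact (idx_lt _ _ _ _ h hb (by omega) (by omega) (by omega)).le

lemma idx_pos (a b : ℕ) (h : a < b) : 1 ≤ idx k a b := by
  rw [idx_eq _ _ h]; omega

lemma pw_succ (m : ℕ) : pw k n (m + 1) = BB k * pw k n m := by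
  unfold pw; ring

lemma pw_mono (hk : 2 ≤ k) {m m' : ℕ} (h : m ≤ m') : pw k n m ≤ pw k n m' := by
  unfold pw
  have := B_ge hk
  exact Nat.mul_le_mul_right _ (Nat.pow_le_pow_right (by omega) h)

lemma pw_lt (hk : 2 ≤ k) {m m' : ℕ} (h : m < m') : BB k * pw k n m ≤ pw k n m' := by
  rw [← pw_succ]; exact pw_mono hk h

lemma pw_y (hk : 2 ≤ k) (hn : 1 ≤ n) (m : ℕ) : BB k * n ^ 4 ≤ pw k n m := by
  refine le_trans ?_ (pw_mono hk (Nat.zero_le m))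
  unfold pw z BB
  rw [pow_zero, one_mul]
  exact Nat.mul_le_mul_left _ (Nat.pow_le_pow_right hn (by norm_num))

lemma y_pos (hn : 1 ≤ n) : 1 ≤ n ^ 4 := Nat.one_le_pow _ _ hn

lemma B_le (hk : 2 ≤ k) (hn : 1 ≤ n) (m : ℕ) : BB k ≤ pw k n m := by
  have := pw_y hk hn m
  have := y_pos hn
  nlinarith

lemma def_bound (hk : 2 ≤ k) (hn : 1 ≤ n) (hx : ∀ i, x i ≤ n ^ 4) (j : ℕ) (i : Fin n) :
    (k - 1) * (pw k n j + x i) + KK k ≤ (k + 1) * pw k n j := by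
  have h1 := hx i
  have h2 := pw_y hk hn j
  have h3 := k_lt hk
  have h4 := KK_lt hk
  have h5 := B_le hk hn j
  obtain ⟨q, rfl⟩ : ∃ q, k = q + 1 := ⟨k - 1, by omega⟩
  simp only [Nat.add_sub_cancel]
  have : q * x i ≤ pw (q + 1) n j := by
    calc q * x i ≤ BB (q + 1) * n ^ 4 := Nat.mul_le_mul (by omega) h1
      _ ≤ _ := h2
  nlinarith

lemma def_bound2 (hk : 2 ≤ k) (hn : 1 ≤ n) (hx : ∀ i, x i ≤ n ^ 4) (j : ℕ) (i : Fin n) :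
    3 * ((k - 1) * (pw k n j + x i) + KK k) ≤ pw k n (k + j) := by
  have h := def_bound hk hn hx j i
  have h3 := k_lt hk
  have h4 := pw_lt (n := n) hk (show j < k + j by omega)
  have h5 := Nat.mul_le_mul_right (pw k n j) h3
  nlinarith

lemma vg_add (hk : 2 ≤ k) (hn : 1 ≤ n) (hx : ∀ i, x i ≤ n ^ 4) (v : Fin k × Fin n) :
    vgSize k n x v + (k - 1) * (pw k n (v.1.1 + 1) + x v.2) = pw k n (k + (v.1.1 + 1)) := by
  have := def_bound2 hk hn hx (v.1.1 + 1) v.2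
  unfold vgSize
  rw [bb_eq, cc_eq]
  rw [mul_add (k - 1)] at this ⊢
  omega

lemma vg_ge (hk : 2 ≤ k) (hn : 1 ≤ n) (hx : ∀ i, x i ≤ n ^ 4) (v : Fin k × Fin n) :
    pw k n (k + (v.1.1 + 1)) ≤ 2 * vgSize k n x v := by
  have := def_bound2 hk hn hx (v.1.1 + 1) v.2
  have := vg_add hk hn hx v
  omega

lemma wt_pos (hk : 2 ≤ k) (hn : 1 ≤ n) (hx : ∀ i, x i ≤ n ^ 4) (s : St k n M) :
    1 ≤ wt x s := by
  have hB := B_ge hk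
  rcases s with v | e | s | c
  · have := vg_ge hk hn hx v
    have := B_le hk hn (k + (v.1.1 + 1))
    change 1 ≤ vgSize k n x v
    omega
  · change 1 ≤ seSize k n e
    unfold seSize
    rw [cjq_eq]
    have := B_le hk hn (2 * k + idx k e.1.1.1.1 e.1.2.1.1)
    omega
  · change 1 ≤ spSize k n x (ep s)
    unfold spSize
    rw [bb_eq]
    have := B_le hk hn ((ep s).1.1 + 1)
    omega
  · change 1 ≤ fixSize k n
    unfold fixSize
    omega

lemma size_le (hk : 2 ≤ k) (g : Grp k) (hg : g ≠ gRest k) :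
    sizesMCC k n x M g ≤ cjq k n (k - 1) k := by
  have : cjq k n (k - 1) k = pw k n (2 * k + idx k (k - 2) (k - 1)) := by
    rw [← cjq_eq]; congr 1 <;> omega
  rw [this]
  rcases g with j | p | _
  · change cc k n _ ≤ _
    rw [cc_eq]
    exact pw_mono hk (by omega)
  · change cjq k n _ _ ≤ _
    rw [cjq_eq]
    exact pw_mono hk (by have := idx_max p.1.1.1 p.1.2.1 p.2 p.1.2.2; omega)
  · exact absurd rfl hg

lemma card_pairs (k : ℕ) : Fintype.card {pq : Fin k × Fin k // pq.1 < pq.2} = k.choose 2 := by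
  have h : ∀ k : ℕ, (∑ i ∈ Finset.range k, i) = k.choose 2 := by
    intro k; rw [Finset.sum_range_id, Nat.choose_two_right]
  rw [Fintype.card_subtype, ← h, ← Fin.sum_univ_eq_sum_range (fun i => i),
    Finset.card_eq_sum_card_fiberwise (f := fun p => p.2) (t := Finset.univ)
      (by intro _ _; simp)]
  refine Finset.sum_congr rfl fun b _ => ?_
  rw [← Fin.card_Iio b]
  refine Finset.card_bij (fun p _ => p.1) ?_ ?_ ?_
  · rintro ⟨a, c⟩ h; simp at h ⊢; rw [← h.2]; exact h.1
  · rintro ⟨a, c⟩ h ⟨a', c'⟩ h' heq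
    simp at h h' heq ⊢
    exact ⟨heq, h.2.trans h'.2.symm⟩
  · intro a ha
    exact ⟨(a, b), by simpa using ha, rfl⟩

noncomputable def sV (x : Fin n → ℕ) (f : St k n M → Grp k) (g : Grp k) : ℕ :=
  ∑ v ∈ Finset.univ.filter (fun v => f (Sum.inl v) = g), vgSize k n x v
noncomputable def sE (f : St k n M → Grp k) (g : Grp k) : ℕ :=
  ∑ e ∈ Finset.univ.filter (fun e => f (Sum.inr (Sum.inl e)) = g), seSize k n e
noncomputable def sS (x : Fin n → ℕ) (f : St k n M → Grp k) (g : Grp k) : ℕ :=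
  ∑ s ∈ Finset.univ.filter (fun s => f (Sum.inr (Sum.inr (Sum.inl s))) = g), spSize k n x (ep s)
noncomputable def sF (f : St k n M → Grp k) (g : Grp k) : ℕ :=
  ∑ _c ∈ Finset.univ.filter (fun c => f (Sum.inr (Sum.inr (Sum.inr c))) = g), fixSize k n

lemma W_eq (f : St k n M → Grp k) (g : Grp k) : W x f g = sV x f g + sE f g + sS x f g + sF f g := by
  unfold W sV sE sS sF
  simp only [Fintype.sum_sum_type, Finset.sum_filter, wt]
  ring

noncomputable def cV (ρ : Grp k) (f : St k n M → Grp k) : Finset (Fin k × Fin n) :=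
  Finset.univ.filter (fun v => f (Sum.inl v) ≠ ρ)
noncomputable def cE (ρ : Grp k) (f : St k n M → Grp k) : Finset (EIdx k n M) :=
  Finset.univ.filter (fun e => f (Sum.inr (Sum.inl e)) ≠ ρ)
noncomputable def cS (f : St k n M → Grp k) : Finset (EIdx k n M × Bool) :=
  Finset.univ.filter (fun s => f (Sum.inr (Sum.inr (Sum.inl s))) ≠ f (Sum.inr (Sum.inl s.1)))
noncomputable def cF (ρ : Grp k) (f : St k n M → Grp k) : Finset (Fin (KK k + 1)) :=
  Finset.univ.filter (fun c => f (Sum.inr (Sum.inr (Sum.inr c))) ≠ ρ)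

lemma cut_eq (ρ : Grp k) (f : St k n M → Grp k) :
    (Finset.univ.filter (fun s => f s ≠ pf ρ f s)).card =
    (cV ρ f).card + (cE ρ f).card + (cS f).card + (cF ρ f).card := by
  unfold cV cE cS cF
  simp only [Finset.card_filter, Fintype.sum_sum_type]
  simp only [pf, ← add_assoc]
  congr!

structure Core (x : Fin n → ℕ) (f : St k n M → Grp k) (L : ℕ) : Prop where
  cut : L + ((cV (gRest k) f).card + (cE (gRest k) f).card + (cS f).card + (cF (gRest k) f).card) ≤ KK k
  lo : ∀ g, W x f g ≤ sizesMCC k n x M g + L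
  hi : ∀ g, g ≠ gRest k → sizesMCC k n x M g ≤ W x f g + L

lemma fix_le (f : St k n M → Grp k) (c) : fixSize k n ≤ W x f (f (Sum.inr (Sum.inr (Sum.inr c)))) := by
  rw [W_eq]
  have : fixSize k n ≤ sF f (f (Sum.inr (Sum.inr (Sum.inr c)))) := by
    unfold sF
    exact Finset.single_le_sum (f := fun _ => fixSize k n) (fun _ _ => Nat.zero_le _)
      (by simp : c ∈ _)
  omega

lemma exists_core (hk : 2 ≤ k) (hn : 1 ≤ n) (hx : ∀ i, x i ≤ n ^ 4) (h : HasSol k n x M) :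
    ∃ (f : St k n M → Grp k) (L : ℕ), Core x f L := by
  obtain ⟨ρ, f, L, h1, h2, h3⟩ := bridge_rev (fun s => wt_pos hk hn hx s) h
  rw [cut_eq] at h1
  have hρ : ρ = gRest k := by
    by_contra hne
    have hs := size_le (n := n) (x := x) (M := M) hk ρ hne
    have : ∃ c, c ∉ cF ρ f := by
      by_contra hall
      push Not at hall
      have : cF ρ f = Finset.univ := Finset.eq_univ_iff_forall.2 hall
      rw [this, Finset.card_univ, Fintype.card_fin] at h1
      omega
    obtain ⟨c, hc⟩ := this
    simp only [cF, Finset.mem_filter, Finset.mem_univ, true_and, not_not] at hc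
    have h4 := fix_le (x := x) f c
    rw [hc] at h4
    have := h2 ρ
    unfold fixSize at h4
    omega
  subst hρ
  exact ⟨f, L, h1, h2, h3⟩

lemma Core.no_fix (hk : 2 ≤ k) {f : St k n M → Grp k} {L : ℕ} (h : Core x f L) (g : Grp k)
    (hg : g ≠ gRest k) : sF f g = 0 := by
  unfold sF
  rw [Finset.filter_false_of_mem, Finset.sum_empty]
  rintro c - rfl
  have h1 := fix_le (x := x) f c
  have h2 := h.lo (f (Sum.inr (Sum.inr (Sum.inr c))))
  have h3 := size_le (n := n) (x := x) (M := M) hk _ hg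
  have h4 := h.cut
  unfold fixSize at h1
  omega

lemma vg_le (hk : 2 ≤ k) (hn : 1 ≤ n) (hx : ∀ i, x i ≤ n ^ 4) (v : Fin k × Fin n) :
    vgSize k n x v ≤ pw k n (k + (v.1.1 + 1)) := by
  have := vg_add hk hn hx v
  omega

lemma se_eq (e : EIdx k n M) : seSize k n e = pw k n (2 * k + idx k e.1.1.1.1 e.1.2.1.1) := by
  unfold seSize; rw [cjq_eq]

lemma sp_eq (v : Fin k × Fin n) : spSize k n x v = pw k n (v.1.1 + 1) + x v.2 := by
  unfold spSize; rw [bb_eq]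

lemma sp_le (hk : 2 ≤ k) (hx : ∀ i, x i ≤ n ^ 4) (v : Fin k × Fin n) :
    spSize k n x v ≤ pw k n k + n ^ 4 := by
  rw [sp_eq]
  exact Nat.add_le_add (pw_mono hk v.1.2) (hx _)

lemma size_pair (p : {pq : Fin k × Fin k // pq.1 < pq.2}) :
    sizesMCC k n x M (gPair p) = pw k n (2 * k + idx k p.1.1.1 p.1.2.1) := by
  change cjq k n _ _ = _
  rw [cjq_eq]

lemma size_col (j : Fin k) : sizesMCC k n x M (gCol j) = pw k n (k + (j.1 + 1)) := by
  change cc k n _ = _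
  rw [cc_eq]

def cls (e : EIdx k n M) : {pq : Fin k × Fin k // pq.1 < pq.2} := ⟨(e.1.1.1, e.1.2.1), e.2.2⟩

lemma arith1 {a b c d L K B u t v1 v2 v3 : ℕ} (hab : a + b + d + L ≤ K) (c3 : c ≤ d + 2 * b)
    (htu : 2 * B * t ≤ u) (huB : B ≤ u) (hB9 : 9 ≤ B) (hKB : K + 4 ≤ B)
    (b1 : v1 ≤ a * u) (b2 : v2 ≤ b * u) (b3 : v3 ≤ c * t) (hh : B * u ≤ v1 + v2 + v3 + L) :
    False := by
  have e1 : c * t ≤ (d + 2 * b) * t := Nat.mul_le_mul_right _ c3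
  have e2 : d * t ≤ d * u := Nat.mul_le_mul_left _ (by nlinarith)
  have e3 : 2 * b * t ≤ u := le_trans (Nat.mul_le_mul_right _ (by omega)) htu
  have e4 : L ≤ L * u := Nat.le_mul_of_pos_right _ (by omega)
  have e5 : (a + b + d + L) * u ≤ K * u := Nat.mul_le_mul_right _ hab
  have e6 : (K + 4) * u ≤ B * u := Nat.mul_le_mul_right _ hKB
  nlinarith

section
variable (hk : 2 ≤ k) (hn : 1 ≤ n) (hx : ∀ i, x i ≤ n ^ 4) {f : St k n M → Grp k} {L : ℕ}
  (h : Core x f L)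
include hk hn hx h

lemma Core.step1 (p : {pq : Fin k × Fin k // pq.1 < pq.2}) :
    ∃ e : EIdx k n M, cls e = p ∧ f (Sum.inr (Sum.inl e)) = gPair p := by
  by_contra hno
  push Not at hno
  have hg : gPair p ≠ gRest k := by simp [gPair, gRest]
  have hF := h.no_fix hk _ hg
  have hlo := h.lo (gPair p)
  have hhi := h.hi _ hg
  have hcut := h.cut
  rw [size_pair, W_eq, hF] at hlo hhi
  have hB9 := B_ge hk
  have hKB := KK_lt hk
  set g := gPair p with hgdef
  have hip := idx_pos (k := k) p.1.1.1 p.1.2.1 p.2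
  set ip := idx k p.1.1.1 p.1.2.1 with hipdef
  obtain ⟨m, hm⟩ : ∃ m, 2 * k + ip = m + 1 := ⟨2 * k + ip - 1, by omega⟩
  rw [hm, pw_succ] at hlo hhi
  set u := pw k n m with hu
  have huB : BB k ≤ u := B_le hk hn m
  have hse : ∀ e : EIdx k n M, f (Sum.inr (Sum.inl e)) = g → seSize k n e ≤ u := by
    intro e he
    have h1 : seSize k n e ≤ sE f g := by
      unfold sE
      exact Finset.single_le_sum (f := fun e => seSize k n e) (fun _ _ => Nat.zero_le _)
        (by simp [he] : e ∈ _)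
    rw [se_eq] at h1 ⊢
    apply pw_mono hk
    by_contra hlt
    have hne : 2 * k + idx k e.1.1.1.1 e.1.2.1.1 ≠ m + 1 := by
      intro heq
      have h2 := idx_inj _ _ _ _ e.2.2 e.1.2.1.2 p.2 p.1.2.2 (by omega)
      apply hno e ?_ he
      apply Subtype.ext
      exact Prod.ext (Fin.ext h2.1) (Fin.ext h2.2)
    have h3 := pw_lt (n := n) hk (show m + 1 < 2 * k + idx k e.1.1.1.1 e.1.2.1.1 by omega)
    rw [pw_succ, ← hu] at h3
    nlinarith
  set t := pw k n k + n ^ 4 with ht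
  have htu : 2 * BB k * t ≤ u := by
    have h1 : BB k * pw k n (k + 1) ≤ u := pw_lt hk (by omega)
    rw [pw_succ] at h1
    have h2 := pw_y hk hn k
    have h3 : 9 * (BB k * pw k n k) ≤ BB k * (BB k * pw k n k) := Nat.mul_le_mul_right _ hB9
    have h4 : 1 * pw k n k ≤ BB k * pw k n k := Nat.mul_le_mul_right _ (by omega)
    have h5 : 2 * BB k * t = 2 * (BB k * pw k n k) + 2 * (BB k * n ^ 4) := by rw [ht]; ring
    omega
  have b1 : sV x f g ≤ (Finset.univ.filter (fun v => f (Sum.inl v) = g)).card * u := by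
    unfold sV
    rw [← smul_eq_mul]
    refine Finset.sum_le_card_nsmul _ _ _ fun v _ => ?_
    exact le_trans (vg_le hk hn hx v) (pw_mono hk (by have := v.1.2; omega))
  have b2 : sE f g ≤ (Finset.univ.filter (fun e => f (Sum.inr (Sum.inl e)) = g)).card * u := by
    unfold sE
    rw [← smul_eq_mul]
    refine Finset.sum_le_card_nsmul _ _ _ fun e he => hse e (by simpa using he)
  have b3 : sS x f g ≤ (Finset.univ.filter (fun s => f (Sum.inr (Sum.inr (Sum.inl s))) = g)).card * t := by
    unfold sS
    rw [← smul_eq_mul]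
    exact Finset.sum_le_card_nsmul _ _ _ fun s _ => sp_le hk hx _
  have c1 : (Finset.univ.filter (fun v => f (Sum.inl v) = g)).card ≤ (cV (gRest k) f).card := by
    apply Finset.card_le_card
    intro v; simp only [cV, Finset.mem_filter, Finset.mem_univ, true_and]
    intro hv; rw [hv]; exact hg
  have c2 : (Finset.univ.filter (fun e => f (Sum.inr (Sum.inl e)) = g)).card ≤ (cE (gRest k) f).card := by
    apply Finset.card_le_card
    intro v; simp only [cE, Finset.mem_filter, Finset.mem_univ, true_and]
    intro hv; rw [hv]; exact hg
  have c3 : (Finset.univ.filter (fun s => f (Sum.inr (Sum.inr (Sum.inl s))) = g)).card ≤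
      (cS f).card + 2 * (Finset.univ.filter (fun e => f (Sum.inr (Sum.inl e)) = g)).card := by
    have : 2 * (Finset.univ.filter (fun e => f (Sum.inr (Sum.inl e)) = g)).card =
      ((Finset.univ.filter (fun e => f (Sum.inr (Sum.inl e)) = g)) ×ˢ (Finset.univ : Finset Bool)).card := by
      rw [Finset.card_product]; simp [mul_comm]
    rw [this]
    refine le_trans (Finset.card_le_card ?_) (Finset.card_union_le _ _)
    intro s
    simp only [cS, Finset.mem_filter, Finset.mem_univ, true_and, Finset.mem_union,
      Finset.mem_product, and_true]
    intro hs
    by_cases h' : f (Sum.inr (Sum.inl s.1)) = g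
    · exact Or.inr h'
    · left; rw [hs]; exact Ne.symm h'
  set a := (Finset.univ.filter (fun v => f (Sum.inl v) = g)).card
  set b := (Finset.univ.filter (fun e => f (Sum.inr (Sum.inl e)) = g)).card
  set c := (Finset.univ.filter (fun s => f (Sum.inr (Sum.inr (Sum.inl s))) = g)).card
  set d := (cS f).card
  exact arith1 (a := a) (b := b) (c := c) (d := d) (L := L) (by omega) c3 htu huB hB9 hKB b1 b2 b3
    (by omega)

/-- no star `S_e` in a color group -/
lemma Core.no_e (j : Fin k) (e : EIdx k n M) : f (Sum.inr (Sum.inl e)) ≠ gCol j := by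
  intro he
  have h1 : seSize k n e ≤ sE f (gCol j) := by
    unfold sE
    exact Finset.single_le_sum (f := fun e => seSize k n e) (fun _ _ => Nat.zero_le _)
      (by simp [he] : e ∈ _)
  have hlo := h.lo (gCol j)
  have hcut := h.cut
  rw [size_col, W_eq] at hlo
  rw [se_eq] at h1
  have hB9 := B_ge hk
  have hKB := KK_lt hk
  have h2 := pw_lt (n := n) hk (show k + (j.1 + 1) < 2 * k + idx k e.1.1.1.1 e.1.2.1.1 by
    have := idx_pos (k := k) _ _ e.2.2; omega)
  have h3 := B_le hk hn (k + (j.1 + 1))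
  nlinarith

lemma Core.sE_zero (j : Fin k) : sE f (gCol j) = 0 := by
  unfold sE
  rw [Finset.filter_false_of_mem, Finset.sum_empty]
  intro e _
  exact h.no_e hk hn hx j e

lemma Core.cut_of_col (j : Fin k) (s : EIdx k n M × Bool)
    (hs : f (Sum.inr (Sum.inr (Sum.inl s))) = gCol j) : s ∈ cS f := by
  simp only [cS, Finset.mem_filter, Finset.mem_univ, true_and]
  rw [hs]
  exact (h.no_e hk hn hx j s.1).symm

lemma Core.colW (j : Fin k) : W x f (gCol j) = sV x f (gCol j) + sS x f (gCol j) := by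
  rw [W_eq, h.sE_zero hk hn hx, h.no_fix hk _ (by simp [gCol, gRest])]
  omega

lemma Core.card_v (j : Fin k) :
    (Finset.univ.filter (fun v => f (Sum.inl v) = gCol j)).card ≤ (cV (gRest k) f).card := by
  apply Finset.card_le_card
  intro v; simp only [cV, Finset.mem_filter, Finset.mem_univ, true_and]
  intro hv; rw [hv]; simp [gCol, gRest]

lemma Core.card_s (j : Fin k) :
    (Finset.univ.filter (fun s => f (Sum.inr (Sum.inr (Sum.inl s))) = gCol j)).card ≤ (cS f).card := by
  apply Finset.card_le_card
  intro s; simp only [Finset.mem_filter, Finset.mem_univ, true_and]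
  exact h.cut_of_col hk hn hx j s

lemma Core.step2 (j : Fin k) : ∃ v : Fin k × Fin n, v.1 = j ∧ f (Sum.inl v) = gCol j := by
  by_contra hno
  push Not at hno
  have hlo := h.lo (gCol j)
  have hhi := h.hi (gCol j) (by simp [gCol, gRest])
  have hcut := h.cut
  have c1 := h.card_v hk hn hx j
  have c3 := h.card_s hk hn hx j
  rw [size_col, h.colW hk hn hx] at hlo hhi
  have hB9 := B_ge hk
  have hKB := KK_lt hk
  rw [show k + (j.1 + 1) = (k + j.1) + 1 by ring, pw_succ] at hlo hhi
  set u := pw k n (k + j.1) with hu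
  have huB : BB k ≤ u := B_le hk hn _
  have huy : BB k * n ^ 4 ≤ u := pw_y hk hn _
  have hse : ∀ v : Fin k × Fin n, f (Sum.inl v) = gCol j → vgSize k n x v ≤ u := by
    intro v hv
    have h1 : vgSize k n x v ≤ sV x f (gCol j) := by
      unfold sV
      exact Finset.single_le_sum (f := fun v => vgSize k n x v) (fun _ _ => Nat.zero_le _)
        (by simp [hv] : v ∈ _)
    refine le_trans (vg_le hk hn hx v) (pw_mono hk ?_)
    by_contra hlt
    have hne : v.1.1 ≠ j.1 := fun heq => hno v (Fin.ext heq) hv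
    have h3 := pw_lt (n := n) hk (show k + j.1 + 1 < k + (v.1.1 + 1) by omega)
    have h4 := vg_ge hk hn hx v
    rw [pw_succ, ← hu] at h3
    nlinarith
  have b1 : sV x f (gCol j) ≤ (Finset.univ.filter (fun v => f (Sum.inl v) = gCol j)).card * u := by
    unfold sV
    rw [← smul_eq_mul]
    exact Finset.sum_le_card_nsmul _ _ _ fun v hv => hse v (by simpa using hv)
  have b3 : sS x f (gCol j) ≤ (Finset.univ.filter
      (fun s => f (Sum.inr (Sum.inr (Sum.inl s))) = gCol j)).card * (u + n ^ 4) := by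
    unfold sS
    rw [← smul_eq_mul]
    refine Finset.sum_le_card_nsmul _ _ _ fun s _ => le_trans (sp_le hk hx _) ?_
    have := pw_mono (n := n) hk (show k ≤ k + j.1 by omega)
    omega
  set a := (Finset.univ.filter (fun v => f (Sum.inl v) = gCol j)).card
  set c := (Finset.univ.filter (fun s => f (Sum.inr (Sum.inr (Sum.inl s))) = gCol j)).card
  have hab : a + c + L ≤ KK k := by omega
  have e2 : c * n ^ 4 ≤ u := le_trans (Nat.mul_le_mul_right _ (by omega)) huy
  have e4 : L ≤ L * u := Nat.le_mul_of_pos_right _ (by omega)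
  have e5 : (a + c + L) * u ≤ KK k * u := Nat.mul_le_mul_right _ hab
  have e6 : (KK k + 4) * u ≤ BB k * u := Nat.mul_le_mul_right _ hKB
  nlinarith

end

lemma arith2 {a l L K B u y q X : ℕ} (hK : a + l + L ≤ K) (hKB : K + 4 ≤ B) (hu : B * y ≤ u)
    (hBu : B ≤ u) (hq : q ≤ B)
    (hh : q * (B * u + X) ≤ a * (B * u + y) + l * (u + y) + L) : q ≤ a := by
  by_contra hlt
  push Not at hlt
  have e1 : (a + 1) * (B * u) ≤ q * (B * u) := Nat.mul_le_mul_right _ hlt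
  have e2 : (a + l) * y ≤ u := le_trans (Nat.mul_le_mul_right _ (by omega)) hu
  have e3 : (l + L) * u ≤ K * u := Nat.mul_le_mul_right _ (by omega)
  have e4 : L ≤ L * u := Nat.le_mul_of_pos_right _ (by omega)
  have e6 : (K + 4) * u ≤ B * u := Nat.mul_le_mul_right _ hKB
  have e7 : 0 ≤ q * X := Nat.zero_le _
  nlinarith

noncomputable def AA (f : St k n M → Grp k) (j : Fin k) : Finset (EIdx k n M × Bool) :=
  Finset.univ.filter (fun s => f (Sum.inr (Sum.inr (Sum.inl s))) = gCol j ∧ (ep s).1 = j)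

section
variable (hk : 2 ≤ k) (hn : 1 ≤ n) (hx : ∀ i, x i ≤ n ^ 4) {f : St k n M → Grp k} {L : ℕ}
  (h : Core x f L)
include hk hn hx h

lemma Core.uniq (v w : Fin k × Fin n) (j : Fin k) (hj : v.1 = j) (hv : f (Sum.inl v) = gCol j)
    (hw : f (Sum.inl w) = gCol j) : w = v := by
  by_contra hne
  have h1 : vgSize k n x v + vgSize k n x w ≤ sV x f (gCol j) := by
    unfold sV
    rw [← Finset.sum_pair (Ne.symm hne)]
    apply Finset.sum_le_sum_of_subset
    intro u hu
    simp only [Finset.mem_insert, Finset.mem_singleton] at hu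
    rcases hu with rfl | rfl <;> simp [hv, hw]
  have hlo := h.lo (gCol j)
  have hcut := h.cut
  rw [size_col, h.colW hk hn hx] at hlo
  have h2 := vg_add hk hn hx v
  have h3 := def_bound hk hn hx (v.1.1 + 1) v.2
  have h4 := vg_ge hk hn hx w
  rw [hj] at h2 h3
  have h5 := pw_mono (n := n) hk (show k + 1 ≤ k + (w.1.1 + 1) by omega)
  rw [pw_succ] at h5
  have h6 := Nat.mul_le_mul_right (pw k n k) (k_lt hk)
  have h7 := Nat.mul_le_mul_left (k + 1) (pw_mono (n := n) hk (show j.1 + 1 ≤ k from j.2))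
  have h8 := B_le hk hn k
  have h9 := B_ge hk
  have h10 : 1 * pw k n k ≤ (k + 1) * pw k n k := Nat.mul_le_mul_right _ (by omega)
  rw [mul_assoc] at h6
  omega

lemma Core.sV_eq (v : Fin k × Fin n) (j : Fin k) (hj : v.1 = j) (hv : f (Sum.inl v) = gCol j) :
    sV x f (gCol j) = vgSize k n x v := by
  unfold sV
  have : Finset.univ.filter (fun v => f (Sum.inl v) = gCol j) = {v} := by
    ext w
    simp only [Finset.mem_filter, Finset.mem_univ, true_and, Finset.mem_singleton]
    exact ⟨h.uniq hk hn hx v w j hj hv, by rintro rfl; exact hv⟩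
  rw [this, Finset.sum_singleton]

lemma Core.col_le (s : EIdx k n M × Bool) (j : Fin k)
    (hs : f (Sum.inr (Sum.inr (Sum.inl s))) = gCol j) : (ep s).1.1 ≤ j.1 := by
  by_contra hlt
  push Not at hlt
  obtain ⟨v, hj, hv⟩ := h.step2 hk hn hx j
  have h1 : spSize k n x (ep s) ≤ sS x f (gCol j) := by
    unfold sS
    exact Finset.single_le_sum (f := fun s => spSize k n x (ep s)) (fun _ _ => Nat.zero_le _)
      (by simp [hs] : s ∈ _)
  have hlo := h.lo (gCol j)
  have hcut := h.cut
  rw [size_col, h.colW hk hn hx, h.sV_eq hk hn hx v j hj hv] at hlo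
  have h2 := vg_add hk hn hx v
  have h3 := def_bound hk hn hx (v.1.1 + 1) v.2
  rw [hj] at h2 h3
  rw [sp_eq] at h1
  have h5 := pw_lt (n := n) hk (show j.1 + 1 < (ep s).1.1 + 1 by omega)
  have h6 := Nat.mul_le_mul_right (pw k n (j.1 + 1)) (k_lt hk)
  have h8 := B_le hk hn (j.1 + 1)
  have h9 := B_ge hk
  have h10 : 1 * pw k n (j.1 + 1) ≤ (k + 1) * pw k n (j.1 + 1) := Nat.mul_le_mul_right _ (by omega)
  rw [mul_assoc] at h6
  omega

lemma Core.step3 (j : Fin k) : k - 1 ≤ (AA f j).card := by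
  obtain ⟨v, hj, hv⟩ := h.step2 hk hn hx j
  have hhi := h.hi (gCol j) (by simp [gCol, gRest])
  have hcut := h.cut
  rw [size_col, h.colW hk hn hx, h.sV_eq hk hn hx v j hj hv] at hhi
  have h2 := vg_add hk hn hx v
  rw [hj] at h2
  have hs := h.card_s hk hn hx j
  have e1 := Finset.sum_filter_add_sum_filter_not (Finset.univ.filter
    (fun s => f (Sum.inr (Sum.inr (Sum.inl s))) = gCol j)) (fun s => (ep s).1 = j)
    (fun s => spSize k n x (ep s))
  have e2 := Finset.card_filter_add_card_filter_not (s := Finset.univ.filter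
    (fun s => f (Sum.inr (Sum.inr (Sum.inl s))) = gCol j)) (fun s => (ep s).1 = j)
  have e3 : Finset.filter (fun s => (ep s).1 = j) (Finset.univ.filter
    (fun s => f (Sum.inr (Sum.inr (Sum.inl s))) = gCol j)) = AA f j := by
    ext s; simp [AA]
  rw [e3] at e1 e2
  set R := Finset.filter (fun s => ¬ (ep s).1 = j) (Finset.univ.filter
    (fun s => f (Sum.inr (Sum.inr (Sum.inl s))) = gCol j)) with hR
  have e4 : ∑ s ∈ AA f j, spSize k n x (ep s) ≤ (AA f j).card * (BB k * pw k n j.1 + n ^ 4) := by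
    rw [← smul_eq_mul]
    refine Finset.sum_le_card_nsmul _ _ _ fun s hs => ?_
    simp only [AA, Finset.mem_filter, Finset.mem_univ, true_and] at hs
    rw [sp_eq, hs.2, pw_succ]
    have := hx (ep s).2
    omega
  have e5 : ∑ s ∈ R, spSize k n x (ep s) ≤ R.card * (pw k n j.1 + n ^ 4) := by
    rw [← smul_eq_mul]
    refine Finset.sum_le_card_nsmul _ _ _ fun s hs => ?_
    simp only [hR, Finset.mem_filter, Finset.mem_univ, true_and] at hs
    have h3 := h.col_le hk hn hx s j hs.1
    have h4 : (ep s).1.1 ≠ j.1 := fun h => hs.2 (Fin.ext h)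
    rw [sp_eq]
    exact Nat.add_le_add (pw_mono hk (by omega)) (hx _)
  have hB := k_lt hk
  refine arith2 (a := (AA f j).card) (l := R.card) (L := L) (X := x v.2) (by omega) (KK_lt hk)
    (pw_y hk hn j.1) (B_le hk hn j.1) (by omega) ?_
  rw [← pw_succ] at e4 ⊢
  unfold sS at hhi
  omega

lemma Core.clique (hxinj : Function.Injective x)
    (hxna : ∀ (g : Fin (k-1) → Fin n) (i : Fin n),
      (∑ j, x (g j)) = (k-1) * x i → ∀ j, x (g j) = x i) : HasMCClique k n M := by
  choose v hv1 hv2 using h.step2 hk hn hx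
  choose e he1 he2 using h.step1 hk hn hx
  have hcut := h.cut
  have n1 : k ≤ (cV (gRest k) f).card := by
    have : (Finset.univ.image v).card = k := by
      rw [Finset.card_image_of_injective, Finset.card_univ, Fintype.card_fin]
      intro a b hab
      rw [← hv1 a, ← hv1 b, hab]
    refine this.symm.le.trans (Finset.card_le_card ?_)
    intro w hw
    simp only [Finset.mem_image, Finset.mem_univ, true_and] at hw
    obtain ⟨j, rfl⟩ := hw
    simp only [cV, Finset.mem_filter, Finset.mem_univ, true_and]
    rw [hv2]
    simp [gCol, gRest]
  have n2 : k.choose 2 ≤ (cE (gRest k) f).card := by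
    have : (Finset.univ.image e).card = k.choose 2 := by
      rw [Finset.card_image_of_injective, Finset.card_univ, card_pairs]
      intro a b hab
      rw [← he1 a, ← he1 b, hab]
    refine this.symm.le.trans (Finset.card_le_card ?_)
    intro w hw
    simp only [Finset.mem_image, Finset.mem_univ, true_and] at hw
    obtain ⟨j, rfl⟩ := hw
    simp only [cE, Finset.mem_filter, Finset.mem_univ, true_and]
    rw [he2]
    simp [gPair, gRest]
  set Q : Finset (EIdx k n M × Bool) :=
    Finset.univ.filter (fun s => f (Sum.inr (Sum.inr (Sum.inl s))) = gCol (ep s).1) with hQ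
  have hQc : Q.card = ∑ j, (AA f j).card := by
    rw [Finset.card_eq_sum_card_fiberwise (f := fun s => (ep s).1) (t := Finset.univ)
      (by intro _ _; simp)]
    refine Finset.sum_congr rfl fun j _ => ?_
    congr 1
    ext s
    simp only [hQ, AA, Finset.mem_filter, Finset.mem_univ, true_and]
    constructor
    · rintro ⟨h1, rfl⟩; exact ⟨h1, rfl⟩
    · rintro ⟨h1, rfl⟩; exact ⟨h1, rfl⟩
  have hQs : Q ⊆ cS f := by
    intro s hs
    simp only [hQ, Finset.mem_filter, Finset.mem_univ, true_and] at hs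
    exact h.cut_of_col hk hn hx _ s hs
  have n3 := Finset.card_le_card hQs
  have n4 : ∑ _j : Fin k, (k - 1) ≤ ∑ j, (AA f j).card :=
    Finset.sum_le_sum fun j _ => h.step3 hk hn hx j
  have n4' := n4
  rw [Finset.sum_const, Finset.card_univ, Fintype.card_fin, smul_eq_mul, ← two_choose] at n4
  unfold KK at hcut
  have hL : L = 0 := by omega
  have hQe : Q = cS f := Finset.eq_of_subset_of_card_le hQs (by omega)
  have hAc : ∀ j, (AA f j).card = k - 1 := by
    have : ∑ _j : Fin k, (k - 1) = ∑ j, (AA f j).card := by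
      apply le_antisymm n4'
      rw [Finset.sum_const, Finset.card_univ, Fintype.card_fin, smul_eq_mul, ← two_choose]
      omega
    intro j
    exact ((Finset.sum_eq_sum_iff_of_le fun j _ => h.step3 hk hn hx j).1 this j
      (Finset.mem_univ j)).symm
  have hcutcol : ∀ s, s ∈ cS f → f (Sum.inr (Sum.inr (Sum.inl s))) = gCol (ep s).1 := by
    intro s hs
    rw [← hQe] at hs
    simpa [hQ] using hs
  -- colour groups
  have key : ∀ s, s ∈ cS f → (ep s).2 = (v (ep s).1).2 := by
    intro s hs
    set j := (ep s).1 with hj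
    have hsA : s ∈ AA f j := by
      simp only [AA, Finset.mem_filter, Finset.mem_univ, true_and]
      exact ⟨hcutcol s hs, rfl⟩
    have hlo := h.lo (gCol j)
    have hhi := h.hi (gCol j) (by simp [gCol, gRest])
    rw [size_col, h.colW hk hn hx, h.sV_eq hk hn hx (v j) j (hv1 j) (hv2 j), hL] at hlo hhi
    have h2 := vg_add hk hn hx (v j)
    rw [hv1 j] at h2
    have hA : Finset.univ.filter (fun s => f (Sum.inr (Sum.inr (Sum.inl s))) = gCol j) = AA f j := by
      ext s'
      simp only [AA, Finset.mem_filter, Finset.mem_univ, true_and]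
      constructor
      · intro h'
        refine ⟨h', ?_⟩
        have := hcutcol s' (h.cut_of_col hk hn hx _ s' h')
        rw [h'] at this
        exact (Sum.inl_injective this).symm
      · exact fun h' => h'.1
    have hsum : sS x f (gCol j) = (k - 1) * pw k n (j.1 + 1) + ∑ s ∈ AA f j, x (ep s).2 := by
      unfold sS
      rw [hA, ← hAc j, ← smul_eq_mul, ← Finset.sum_const, ← Finset.sum_add_distrib]
      refine Finset.sum_congr rfl fun s' hs' => ?_
      simp only [AA, Finset.mem_filter, Finset.mem_univ, true_and] at hs'
      rw [sp_eq, hs'.2]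
    rw [mul_add] at h2
    have hfin : ∑ s ∈ AA f j, x (ep s).2 = (k - 1) * x (v j).2 := by omega
    let eq := Finset.equivFinOfCardEq (hAc j)
    have hre : ∑ i : Fin (k - 1), x (ep (eq.symm i).1).2 = (k - 1) * x (v j).2 := by
      rw [← hfin, ← Finset.sum_coe_sort (AA f j), ← Equiv.sum_comp eq.symm]
    have := hxna (fun i => (ep (eq.symm i).1).2) (v j).2 hre (eq ⟨s, hsA⟩)
    rw [Equiv.symm_apply_apply] at this
    exact hxinj this
  have hboth : ∀ p b, (e p, b) ∈ cS f := by
    intro p b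
    simp only [cS, Finset.mem_filter, Finset.mem_univ, true_and]
    rw [he2 p]
    intro hs
    have hlo := h.lo (gPair p)
    rw [size_pair, W_eq, hL] at hlo
    have h1 : spSize k n x (ep (e p, b)) ≤ sS x f (gPair p) := by
      unfold sS
      exact Finset.single_le_sum (f := fun s => spSize k n x (ep s)) (fun _ _ => Nat.zero_le _)
        (by simp [hs] : (e p, b) ∈ _)
    have h2 : seSize k n (e p) ≤ sE f (gPair p) := by
      unfold sE
      exact Finset.single_le_sum (f := fun e => seSize k n e) (fun _ _ => Nat.zero_le _)
        (by simp [he2] : e p ∈ _)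
    have h3 : seSize k n (e p) = pw k n (2 * k + idx k p.1.1.1 p.1.2.1) := by
      have c1 : (e p).1.1.1 = p.1.1 := congrArg (fun q => q.1.1) (he1 p)
      have c2 : (e p).1.2.1 = p.1.2 := congrArg (fun q => q.1.2) (he1 p)
      rw [se_eq, c1, c2]
    have h4 := wt_pos hk hn hx (Sum.inr (Sum.inr (Sum.inl (e p, b))) : St k n M)
    change 1 ≤ spSize k n x (ep (e p, b)) at h4
    omega
  have hadj : ∀ p : {pq : Fin k × Fin k // pq.1 < pq.2},
      M.Adj (p.1.1, (v p.1.1).2) (p.1.2, (v p.1.2).2) := by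
    intro p
    have k1 := key _ (hboth p true)
    have k2 := key _ (hboth p false)
    simp only [ep, if_true] at k1
    simp only [ep, Bool.false_eq_true, if_false] at k2
    have c1 : (e p).1.1.1 = p.1.1 := congrArg (fun q => q.1.1) (he1 p)
    have c2 : (e p).1.2.1 = p.1.2 := congrArg (fun q => q.1.2) (he1 p)
    rw [c1] at k1
    rw [c2] at k2
    have := (e p).2.1
    rwa [show (e p).1.1 = (p.1.1, (v p.1.1).2) from Prod.ext c1 k1,
      show (e p).1.2 = (p.1.2, (v p.1.2).2) from Prod.ext c2 k2] at this
  refine ⟨fun j => (v j).2, fun j j' hne => ?_⟩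
  rcases lt_or_gt_of_ne hne with hlt | hlt
  · exact hadj ⟨(j, j'), hlt⟩
  · exact (hadj ⟨(j', j), hlt⟩).symm

end

def Sel (sel : Fin k → Fin n) (e : EIdx k n M) : Prop :=
  e.1.1.2 = sel e.1.1.1 ∧ e.1.2.2 = sel e.1.2.1

def es (sel : Fin k → Fin n) (hs : ∀ j j' : Fin k, j ≠ j' → M.Adj (j, sel j) (j', sel j'))
    (p : {pq : Fin k × Fin k // pq.1 < pq.2}) : EIdx k n M :=
  ⟨((p.1.1, sel p.1.1), (p.1.2, sel p.1.2)), hs _ _ p.2.ne, p.2⟩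

lemma Sel_es (sel : Fin k → Fin n) (hs : ∀ j j' : Fin k, j ≠ j' → M.Adj (j, sel j) (j', sel j'))
    (p : {pq : Fin k × Fin k // pq.1 < pq.2}) : Sel sel (es sel hs p) := ⟨rfl, rfl⟩

lemma es_cls (sel : Fin k → Fin n) (hs : ∀ j j' : Fin k, j ≠ j' → M.Adj (j, sel j) (j', sel j'))
    (e : EIdx k n M) (h : Sel sel e) : es sel hs (cls e) = e := by
  apply Subtype.ext
  refine Prod.ext (Prod.ext rfl h.1.symm) (Prod.ext rfl h.2.symm)

noncomputable def ff (sel : Fin k → Fin n) : St k n M → Grp k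
  | Sum.inl v => if v.2 = sel v.1 then gCol v.1 else gRest k
  | Sum.inr (Sum.inl e) => if Sel sel e then gPair (cls e) else gRest k
  | Sum.inr (Sum.inr (Sum.inl s)) => if Sel sel s.1 then gCol (ep s).1 else gRest k
  | Sum.inr (Sum.inr (Sum.inr _)) => gRest k

lemma card_sel (sel : Fin k → Fin n) (hs : ∀ j j' : Fin k, j ≠ j' → M.Adj (j, sel j) (j', sel j'))
    (j : Fin k) :
    (Finset.univ.filter (fun s : EIdx k n M × Bool => Sel sel s.1 ∧ (ep s).1 = j)).card = k - 1 := by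
  have h0 : (Finset.univ.erase j).card = k - 1 := by
    rw [Finset.card_erase_of_mem (Finset.mem_univ j), Finset.card_univ, Fintype.card_fin]
  rw [← h0]
  refine Finset.card_bij (fun s _ => (ep (s.1, !s.2)).1) ?_ ?_ ?_
  · rintro ⟨e, b⟩ h
    simp only [Finset.mem_filter, Finset.mem_univ, true_and] at h
    rw [Finset.mem_erase]
    refine ⟨?_, Finset.mem_univ _⟩
    rw [← h.2]
    have := e.2.2
    cases b
    · simpa [ep] using this.ne
    · simpa [ep] using this.ne'
  · rintro ⟨e, b⟩ h ⟨e', b'⟩ h' hh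
    simp only [Finset.mem_filter, Finset.mem_univ, true_and] at h h'
    have l1 := e.2.2
    have l2 := e'.2.2
    rw [← es_cls sel hs e h.1, ← es_cls sel hs e' h'.1]
    have h2 := h.2.trans h'.2.symm
    cases b <;> cases b' <;> simp [ep] at hh h2
    · have : cls e = cls e' := Subtype.ext (Prod.ext hh h2)
      rw [this]
    · rw [hh, h2] at l1
      exact absurd l1 l2.not_gt
    · rw [hh, h2] at l1
      exact absurd l1 l2.not_gt
    · have : cls e = cls e' := Subtype.ext (Prod.ext h2 hh)
      rw [this]
  · intro q hq
    have hq := Finset.ne_of_mem_erase hq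
    rcases lt_or_gt_of_ne hq with hlt | hlt
    · refine ⟨(es sel hs ⟨(q, j), hlt⟩, false), ?_, ?_⟩
      · simp only [Finset.mem_filter, Finset.mem_univ, true_and]
        exact ⟨Sel_es _ _ _, rfl⟩
      · rfl
    · refine ⟨(es sel hs ⟨(j, q), hlt⟩, true), ?_, ?_⟩
      · simp only [Finset.mem_filter, Finset.mem_univ, true_and]
        exact ⟨Sel_es _ _ _, rfl⟩
      · rfl

lemma fwd (hk : 2 ≤ k) (hn : 1 ≤ n) (hx : ∀ i, x i ≤ n ^ 4) (h : HasMCClique k n M) :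
    HasSol k n x M := by
  obtain ⟨sel, hs⟩ := h
  refine bridge_fwd (fun s => wt_pos hk hn hx s) (ff sel) ?_ ?_
  · rw [cut_eq]
    have h1 : (cV (gRest k) (ff (M := M) sel)).card ≤ k := by
      refine le_trans (Finset.card_le_card (t := Finset.univ.image fun j => (j, sel j)) ?_) ?_
      · intro v hv
        simp only [cV, Finset.mem_filter, Finset.mem_univ, true_and] at hv
        simp only [ff] at hv
        have : v.2 = sel v.1 := by
          by_contra hne
          simp [hne] at hv
        exact Finset.mem_image.2 ⟨v.1, Finset.mem_univ _, Prod.ext rfl this.symm⟩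
      · refine Finset.card_image_le.trans ?_
        simp
    have h2 : (cE (gRest k) (ff (M := M) sel)).card ≤ k.choose 2 := by
      refine le_trans (Finset.card_le_card (t := Finset.univ.image (es sel hs)) ?_) ?_
      · intro e he
        simp only [cE, Finset.mem_filter, Finset.mem_univ, true_and] at he
        simp only [ff] at he
        have : Sel sel e := by
          by_contra hne
          simp [hne] at he
        exact Finset.mem_image.2 ⟨cls e, Finset.mem_univ _, es_cls sel hs e this⟩
      · refine Finset.card_image_le.trans ?_
        rw [Finset.card_univ, card_pairs]
    have h3 : (cS (ff (M := M) sel)).card ≤ k.choose 2 * 2 := by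
      refine le_trans (Finset.card_le_card (t := Finset.univ.image
        (fun q : {pq : Fin k × Fin k // pq.1 < pq.2} × Bool => (es sel hs q.1, q.2))) ?_) ?_
      · intro s hs'
        simp only [cS, Finset.mem_filter, Finset.mem_univ, true_and] at hs'
        simp only [ff] at hs'
        have : Sel sel s.1 := by
          by_contra hne
          simp [hne] at hs'
        exact Finset.mem_image.2 ⟨(cls s.1, s.2), Finset.mem_univ _,
          Prod.ext (es_cls sel hs s.1 this) rfl⟩
      · refine Finset.card_image_le.trans ?_
        rw [Finset.card_univ, Fintype.card_prod, card_pairs, Fintype.card_bool]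
    have h4 : (cF (gRest k) (ff (M := M) sel)).card = 0 := by
      rw [Finset.card_eq_zero]
      unfold cF
      exact Finset.filter_false_of_mem fun c _ h => h rfl
    rw [h4]
    unfold KK
    omega
  · intro g hg
    rw [W_eq]
    have hF : sF (ff (M := M) sel) g = 0 := by
      unfold sF
      rw [Finset.filter_false_of_mem, Finset.sum_empty]
      intro c _
      exact fun h => hg h.symm
    rw [hF]
    rcases g with j | p | u
    · change sV x (ff sel) (gCol j) + sE (ff sel) (gCol j) + sS x (ff sel) (gCol j) + 0
        = sizesMCC k n x M (gCol j)
      have hV : sV x (ff (M := M) sel) (gCol j) = vgSize k n x (j, sel j) := by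
        unfold sV
        have : Finset.univ.filter (fun v => ff (M := M) sel (Sum.inl v) = gCol j)
            = {(j, sel j)} := by
          ext ⟨a, i⟩
          simp only [Finset.mem_filter, Finset.mem_univ, true_and, Finset.mem_singleton]
          simp only [ff]
          constructor
          · intro h
            by_cases hi : i = sel a
            · rw [if_pos hi] at h
              obtain rfl := Sum.inl_injective h
              rw [hi]
            · rw [if_neg hi] at h
              simp [gRest, gCol] at h
          · rintro h
            obtain ⟨rfl, rfl⟩ := Prod.mk.inj h
            simp
        rw [this, Finset.sum_singleton]
      have hE : sE (ff (M := M) sel) (gCol j) = 0 := by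
        unfold sE
        rw [Finset.filter_false_of_mem, Finset.sum_empty]
        intro e _
        simp only [ff]
        split_ifs <;> simp [gPair, gRest, gCol]
      have hS : sS x (ff (M := M) sel) (gCol j) = (k - 1) * (pw k n (j.1 + 1) + x (sel j)) := by
        unfold sS
        have : Finset.univ.filter (fun s => ff (M := M) sel (Sum.inr (Sum.inr (Sum.inl s))) = gCol j)
            = Finset.univ.filter (fun s : EIdx k n M × Bool => Sel sel s.1 ∧ (ep s).1 = j) := by
          ext s
          simp only [Finset.mem_filter, Finset.mem_univ, true_and]
          simp only [ff]
          by_cases hi : Sel sel s.1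
          · simp [hi, gCol]
          · simp [hi, gCol, gRest]
        rw [this, ← card_sel sel hs j, ← smul_eq_mul, ← Finset.sum_const]
        refine Finset.sum_congr rfl fun s hs' => ?_
        simp only [Finset.mem_filter, Finset.mem_univ, true_and] at hs'
        have h2 : (ep s).2 = sel (ep s).1 := by
          obtain ⟨e, b⟩ := s
          cases b
          · exact hs'.1.2
          · exact hs'.1.1
        rw [sp_eq, h2, hs'.2]
      have := vg_add hk hn hx (j, sel j)
      rw [hV, hE, hS, size_col]
      simp only at this
      omega
    · change sV x (ff sel) (gPair p) + sE (ff sel) (gPair p) + sS x (ff sel) (gPair p) + 0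
        = sizesMCC k n x M (gPair p)
      have hV : sV x (ff (M := M) sel) (gPair p) = 0 := by
        unfold sV
        rw [Finset.filter_false_of_mem, Finset.sum_empty]
        intro e _
        simp only [ff]
        split_ifs <;> simp [gPair, gRest, gCol]
      have hS : sS x (ff (M := M) sel) (gPair p) = 0 := by
        unfold sS
        rw [Finset.filter_false_of_mem, Finset.sum_empty]
        intro e _
        simp only [ff]
        split_ifs <;> simp [gPair, gRest, gCol]
      have hE : sE (ff (M := M) sel) (gPair p) = seSize k n (es sel hs p) := by
        unfold sE
        have : Finset.univ.filter (fun e => ff (M := M) sel (Sum.inr (Sum.inl e)) = gPair p)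
            = {es sel hs p} := by
          ext e
          simp only [Finset.mem_filter, Finset.mem_univ, true_and, Finset.mem_singleton]
          simp only [ff]
          constructor
          · intro h
            by_cases hi : Sel sel e
            · rw [if_pos hi] at h
              obtain rfl := Sum.inl_injective (Sum.inr_injective h)
              exact (es_cls sel hs e hi).symm
            · rw [if_neg hi] at h
              simp [gRest, gPair] at h
          · rintro rfl
            rw [if_pos (Sel_es sel hs p)]
            rfl
        rw [this, Finset.sum_singleton]
      rw [hV, hE, hS, size_pair, se_eq]
      simp [es]
    · exact absurd rfl hg


end aux

end MCC

open MCC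

/-- Correctness of the FPT-reduction: `M` contains a multicolored `k`-clique if and only
if the instance `I'` has a solution. -/
theorem statement12
    (k n : ℕ) (hk : 2 ≤ k) (hn : 1 ≤ n)
    (x : Fin n → ℕ) (hxinj : Function.Injective x) (hxbd : ∀ i, x i ≤ n^4)
    (hxna : ∀ (g : Fin (k-1) → Fin n) (i : Fin n),
      (∑ j, x (g j)) = (k-1) * x i → ∀ j, x (g j) = x i)
    (M : SimpleGraph (Fin k × Fin n)) (hM : ∀ u w, M.Adj u w → u.1 ≠ w.1)
    : HasMCClique k n M ↔ HasSol k n x M := by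
  constructor
  · exact fwd hk hn hxbd
  · intro h
    obtain ⟨f, L, hc⟩ := exists_core hk hn hxbd h
    exact hc.clique hk hn hxbd hxinj hxna
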